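/- For every u = (u₁,u₂) with u₁ ∈ C⁴(cl B⁵;ℂ), u₂ ∈ C³(cl B⁵;ℂ): Re (L̃u | u)₅ = −‖u‖₅², where ‖u‖₅² := (u|u)₅. -/

import Mathlib

open MeasureTheory ComplexConjugate

noncomputable section

abbrev E5 : Type := EuclideanSpace ℝ (Fin 5)

/-- the partial derivative in the `i`-th coordinate direction -/
def pd (i : Fin 5) (f : E5 → ℂ) : E5 → ℂ :=
  fun x => fderiv ℝ f x (EuclideanSpace.single i 1)

/-- the iterated partial derivative `∂^β` for a multi-index `β` -/
def pdM (β : Fin 5 → ℕ) (f : E5 → ℂ) : E5 → ℂ :=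
  (List.finRange 5).foldr (fun i g => (pd i)^[β i] g) f

/-- the Laplacian `Δf = ∑_j ∂_j∂_j f` -/
def lap (f : E5 → ℂ) : E5 → ℂ := fun x => ∑ j : Fin 5, pd j (pd j f) x

/-- the open unit ball `B⁵ ⊆ ℝ⁵` -/
def ball5 : Set E5 := Metric.ball 0 1

/-- the unit sphere `S⁴ = ∂B⁵` -/
def sph4 : Set E5 := Metric.sphere 0 1

/-- the squared `L²` norm over the unit ball -/
def bL2Sq (f : E5 → ℂ) : ℝ := ∫ x in ball5, ‖f x‖ ^ 2

/-- the squared `H^m(B⁵)` norm: `∑_{|β| ≤ m} ‖∂^β f‖²_{L²(B⁵)}` -/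
def HSq (m : ℕ) (f : E5 → ℂ) : ℝ :=
  ∑ β : Fin 5 → Fin (m + 1),
    if (∑ i, (β i : ℕ)) ≤ m then bL2Sq (pdM (fun i => (β i : ℕ)) f) else 0

/-- the sesquilinear form `(u|v)₁` -/
def ip1 (u v : (E5 → ℂ) × (E5 → ℂ)) : ℂ :=
  (∑ i : Fin 5, ∑ j : Fin 5, ∑ k : Fin 5,
      ∫ x in ball5, pd i (pd j (pd k u.1)) x * conj (pd i (pd j (pd k v.1)) x)) +
    (∑ i : Fin 5, ∑ j : Fin 5,
      ∫ x in ball5, pd i (pd j u.2) x * conj (pd i (pd j v.2) x)) +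
    (∑ i : Fin 5, ∑ j : Fin 5,
      ∫ ω in sph4, pd i (pd j u.1) ω * conj (pd i (pd j v.1) ω) ∂μH[4])

/-- the sesquilinear form `(u|v)₂` -/
def ip2 (u v : (E5 → ℂ) × (E5 → ℂ)) : ℂ :=
  (∑ i : Fin 5, ∫ x in ball5, pd i (lap u.1) x * conj (pd i (lap v.1) x)) +
    (∑ i : Fin 5, ∑ j : Fin 5,
      ∫ x in ball5, pd i (pd j u.2) x * conj (pd i (pd j v.2) x)) +
    (∑ j : Fin 5, ∫ ω in sph4, pd j u.2 ω * conj (pd j v.2 ω) ∂μH[4])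

/-- the sesquilinear form `(u|v)₃` -/
def ip3 (u v : (E5 → ℂ) × (E5 → ℂ)) : ℂ :=
  5 * ip1 u v + ip2 u v + ∫ ω in sph4, u.2 ω * conj (v.2 ω) ∂μH[4]

/-- the sesquilinear form `(u|v)₄` -/
def ip4 (u v : (E5 → ℂ) × (E5 → ℂ)) : ℂ :=
  ip1 u v + ip2 u v + ∑ i : Fin 5, ∫ ω in sph4, pd i u.1 ω * conj (pd i v.1 ω) ∂μH[4]

/-- `ζ(ω, w(ω)) = ω^iω^j ∂_i∂_j w₁(ω) + 5ω^i ∂_i w₁(ω) + 3w₁(ω) + ω^j ∂_j w₂(ω) + 3w₂(ω)` -/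
def zeta (w : (E5 → ℂ) × (E5 → ℂ)) (ω : E5) : ℂ :=
  (∑ i : Fin 5, ∑ j : Fin 5, (ω i : ℂ) * (ω j : ℂ) * pd i (pd j w.1) ω) +
    5 * (∑ i : Fin 5, (ω i : ℂ) * pd i w.1 ω) + 3 * w.1 ω +
    (∑ j : Fin 5, (ω j : ℂ) * pd j w.2 ω) + 3 * w.2 ω

/-- the sesquilinear form `(u|v)₅` -/
def ip5 (u v : (E5 → ℂ) × (E5 → ℂ)) : ℂ :=
  (∫ ω in sph4, zeta u ω ∂μH[4]) * conj (∫ ω in sph4, zeta v ω ∂μH[4])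

/-- the full sesquilinear form `(u|v) = ∑_{i=1}^{5} (u|v)_i` -/
def ipT (u v : (E5 → ℂ) × (E5 → ℂ)) : ℂ :=
  ip1 u v + ip2 u v + ip3 u v + ip4 u v + ip5 u v

/-- the free operator `L̃u = (−ξ^j ∂_j u₁ − u₁ + u₂, Δu₁ − ξ^j ∂_j u₂ − 2u₂)` -/
def Ltil (u : (E5 → ℂ) × (E5 → ℂ)) : (E5 → ℂ) × (E5 → ℂ) :=
  (fun ξ => -(∑ j : Fin 5, (ξ j : ℂ) * pd j u.1 ξ) - u.1 ξ + u.2 ξ,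
   fun ξ => lap u.1 ξ - (∑ j : Fin 5, (ξ j : ℂ) * pd j u.2 ξ) - 2 * u.2 ξ)

/-- The map from `ℝ⁴` to the sphere obtained by projecting radially the affine hyperplane
`{y | y i = c}`. -/
def faceToSphere (i : Fin 5) (c : ℝ) (z : Fin 4 → ℝ) : E5 :=
  ‖(WithLp.toLp 2 (i.insertNth c z) : E5)‖⁻¹ • (WithLp.toLp 2 (i.insertNth c z) : E5)

theorem contDiff_faceToSphere (i : Fin 5) {c : ℝ} (hc : c ≠ 0) :
    ContDiff ℝ 1 (faceToSphere i c) := by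
  have h : ContDiff ℝ 1 fun z : Fin 4 → ℝ => (WithLp.toLp 2 (i.insertNth c z) : E5) := by
    rw [contDiff_euclidean]
    intro k
    induction k using i.succAboveCases with
    | x => simpa using contDiff_const
    | p k => simpa using contDiff_apply ℝ ℝ k
  have h0 (z : Fin 4 → ℝ) : (WithLp.toLp 2 (i.insertNth c z) : E5) ≠ 0 := by
    intro hz
    have := congrArg (fun y : E5 => y i) hz
    simp [hc] at this
  exact ((h.norm ℝ h0).inv fun z => norm_ne_zero_iff.2 (h0 z)).smul h

theorem sphere_subset_iUnion_faceToSphere :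
    sph4 ⊆ ⋃ i : Fin 5, ⋃ c ∈ ({1, -1} : Set ℝ),
      faceToSphere i c '' Set.Icc (fun _ => -1) (fun _ => 1) := by
  intro x hx
  have hx1 : ‖x‖ = 1 := by simpa [sph4] using hx
  obtain ⟨i, -, hi⟩ := Finset.exists_max_image Finset.univ (fun k => |x k|) ⟨0, Finset.mem_univ _⟩
  have hpos : 0 < |x i| := by
    by_contra hle
    have : x = 0 := by
      ext k
      exact abs_nonpos_iff.1 ((hi k (Finset.mem_univ k)).trans (not_lt.1 hle))
    simp [this] at hx1
  have hne : x i ≠ 0 := abs_pos.1 hpos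
  simp only [Set.mem_iUnion]
  refine ⟨i, x i / |x i|, ?_, fun k => x (i.succAbove k) / |x i|, ?_, ?_⟩
  · rcases abs_cases (x i) with ⟨h, -⟩ | ⟨h, -⟩ <;> rw [h] <;> simp [hne]
  · have hk (k : Fin 4) : |x (i.succAbove k) / (|x i|)| ≤ 1 := by
      rw [abs_div, abs_abs, div_le_one hpos]
      exact hi _ (Finset.mem_univ _)
    exact ⟨fun k => (abs_le.1 (hk k)).1, fun k => (abs_le.1 (hk k)).2⟩
  · have hy : (WithLp.toLp 2 (i.insertNth (x i / |x i|)
        fun k => x (i.succAbove k) / |x i|) : E5) = |x i|⁻¹ • x := by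
      ext k
      induction k using i.succAboveCases with
      | x => simp [div_eq_inv_mul]
      | p k => simp [div_eq_inv_mul]
    rw [faceToSphere, hy, norm_smul, hx1, smul_smul]
    simp [hne]

theorem hausdorffMeasure_sphere_lt_top : (μH[4] : Measure E5) sph4 < ⊤ := by
  refine (measure_mono sphere_subset_iUnion_faceToSphere).trans_lt ?_
  refine (measure_iUnion_le _).trans_lt ?_
  rw [tsum_fintype]
  refine ENNReal.sum_lt_top.2 fun i _ => ?_
  refine measure_biUnion_lt_top (Set.toFinite _) fun c hc => ?_
  have hc0 : c ≠ 0 := by rcases hc with rfl | rfl <;> norm_num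
  obtain ⟨K, hK⟩ := (contDiff_faceToSphere i hc0).contDiffOn.exists_lipschitzOnWith one_ne_zero
    (convex_Icc (fun _ : Fin 4 => (-1 : ℝ)) fun _ => 1) isCompact_Icc
  refine (hK.hausdorffMeasure_image_le (by norm_num : (0 : ℝ) ≤ 4)).trans_lt ?_
  have hvol : (μH[4] : Measure (Fin 4 → ℝ)) = volume := by
    simpa using hausdorffMeasure_pi_real (ι := Fin 4)
  rw [hvol]
  exact ENNReal.mul_lt_top (ENNReal.rpow_lt_top_of_nonneg (by norm_num) ENNReal.coe_ne_top)
    isCompact_Icc.measure_lt_top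

instance : IsFiniteMeasure ((μH[4] : Measure E5).restrict sph4) :=
  ⟨by simpa using hausdorffMeasure_sphere_lt_top⟩

theorem measurableSet_sph4 : MeasurableSet sph4 := Metric.isClosed_sphere.measurableSet

theorem isCompact_sph4 : IsCompact sph4 := isCompact_sphere 0 1

theorem integrable_sphere {f : E5 → ℂ} (hf : Continuous f) :
    Integrable f ((μH[4] : Measure E5).restrict sph4) :=
  hf.continuousOn.integrableOn_of_subset_isCompact isCompact_sph4 measurableSet_sph4 subset_rfl
    hausdorffMeasure_sphere_lt_top.ne

/-- The rotation by the angle `t` in the plane spanned by the coordinate directions `i ≠ j`. -/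
def planeRot (i j : Fin 5) (t : ℝ) (x : E5) : E5 :=
  x + ((Real.cos t - 1) * x i - Real.sin t * x j) • EuclideanSpace.single i (1 : ℝ) +
    (Real.sin t * x i + (Real.cos t - 1) * x j) • EuclideanSpace.single j (1 : ℝ)

theorem norm_planeRot {i j : Fin 5} (hij : i ≠ j) (t : ℝ) (x : E5) : ‖planeRot i j t x‖ = ‖x‖ := by
  rw [← sq_eq_sq₀ (norm_nonneg _) (norm_nonneg _)]
  rw [planeRot, norm_add_sq_real, norm_add_sq_real, inner_add_left]
  simp [inner_smul_left, inner_smul_right, EuclideanSpace.inner_single_right, norm_smul,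
    hij.symm]
  linear_combination (x i ^ 2 + x j ^ 2) * Real.sin_sq_add_cos_sq t

theorem planeRot_apply_left {i j : Fin 5} (hij : i ≠ j) (t : ℝ) (x : E5) :
    planeRot i j t x i = Real.cos t * x i - Real.sin t * x j := by
  simp [planeRot, hij]
  ring

theorem planeRot_apply_right {i j : Fin 5} (hij : i ≠ j) (t : ℝ) (x : E5) :
    planeRot i j t x j = Real.sin t * x i + Real.cos t * x j := by
  simp [planeRot, hij.symm]
  ring

/-- `planeRot` as a linear isometry. -/
def planeRotIsometry {i j : Fin 5} (hij : i ≠ j) (t : ℝ) : E5 →ₗᵢ[ℝ] E5 where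
  toFun := planeRot i j t
  map_add' x y := by simp only [planeRot, PiLp.add_apply]; module
  map_smul' c x := by
    simp only [planeRot, PiLp.smul_apply, smul_eq_mul, RingHom.id_apply]; module
  norm_map' x := norm_planeRot hij t x

theorem planeRot_mem_sph4 {i j : Fin 5} (hij : i ≠ j) (t : ℝ) {x : E5} :
    planeRot i j t x ∈ sph4 ↔ x ∈ sph4 := by
  simp [sph4, norm_planeRot hij]

theorem setIntegral_comp_planeRot {i j : Fin 5} (hij : i ≠ j) (t : ℝ) (f : E5 → ℂ) :
    ∫ ω in sph4, f (planeRot i j t ω) ∂μH[4] = ∫ ω in sph4, f ω ∂μH[4] := by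
  let e := ((planeRotIsometry hij t).toLinearIsometryEquiv rfl).toIsometryEquiv
  have he (x : E5) : e x = planeRot i j t x := rfl
  have hpre : e ⁻¹' sph4 = sph4 := by
    ext x
    exact planeRot_mem_sph4 hij t
  have := (e.measurePreserving_hausdorffMeasure 4).setIntegral_preimage_emb
    e.toHomeomorph.measurableEmbedding f sph4
  rwa [hpre] at this

/-- The generator `x_i ∂_j - x_j ∂_i` of the rotations in the `i`-`j`-plane. -/
def rotDeriv (i j : Fin 5) (f : E5 → ℂ) (x : E5) : ℂ := x i * pd j f x - x j * pd i f x

theorem ContDiff.pd {n m : ℕ∞} {f : E5 → ℂ} (hf : ContDiff ℝ m f) (hnm : n + 1 ≤ m) (i : Fin 5) :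
    ContDiff ℝ n (pd i f) :=
  (hf.fderiv_right (by exact_mod_cast hnm)).clm_apply contDiff_const

theorem contDiff_coord {n : WithTop ℕ∞} (i : Fin 5) : ContDiff ℝ n fun x : E5 => (x i : ℂ) :=
  Complex.ofRealCLM.contDiff.comp (EuclideanSpace.proj (𝕜 := ℝ) i).contDiff

theorem ContDiff.rotDeriv {n m : ℕ∞} {f : E5 → ℂ} (hf : ContDiff ℝ m f) (hnm : n + 1 ≤ m)
    (i j : Fin 5) : ContDiff ℝ n (rotDeriv i j f) :=
  ((contDiff_coord i).mul (hf.pd hnm j)).sub ((contDiff_coord j).mul (hf.pd hnm i))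

theorem hasDerivAt_comp_planeRot {i j : Fin 5} (hij : i ≠ j) {f : E5 → ℂ}
    (hf : Differentiable ℝ f) (t : ℝ) (x : E5) :
    HasDerivAt (fun s => f (planeRot i j s x)) (rotDeriv i j f (planeRot i j t x)) t := by
  have hR : HasDerivAt (fun s => planeRot i j s x)
      ((planeRot i j t x i) • EuclideanSpace.single j (1 : ℝ) -
        (planeRot i j t x j) • EuclideanSpace.single i (1 : ℝ)) t := by
    have h1 := (((((Real.hasDerivAt_cos t).sub_const 1).mul_const (x i)).sub
      ((Real.hasDerivAt_sin t).mul_const (x j))).smul_const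
        (EuclideanSpace.single i (1 : ℝ))).const_add x
    have h2 := (((Real.hasDerivAt_sin t).mul_const (x i)).add
      (((Real.hasDerivAt_cos t).sub_const 1).mul_const (x j))).smul_const
        (EuclideanSpace.single j (1 : ℝ))
    refine (h1.add h2).congr_deriv ?_
    rw [planeRot_apply_left hij, planeRot_apply_right hij]
    module
  refine ((hf _).hasFDerivAt.comp_hasDerivAt t hR).congr_deriv ?_
  simp [rotDeriv, pd]

theorem setIntegral_rotDeriv_eq_zero (i j : Fin 5) {f : E5 → ℂ} (hf : ContDiff ℝ 1 f) :
    ∫ ω in sph4, rotDeriv i j f ω ∂μH[4] = 0 := by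
  rcases eq_or_ne i j with rfl | hij
  · simp [rotDeriv]
  have hcont : Continuous (rotDeriv i j f) :=
    (ContDiff.rotDeriv (n := 0) (m := 1) hf (by norm_num) i j).continuous
  have hrot (t : ℝ) : Continuous (planeRot i j t) := (planeRotIsometry hij t).continuous
  obtain ⟨C, hC⟩ := isCompact_sph4.exists_bound_of_continuousOn hcont.continuousOn
  have hder := (hasDerivAt_integral_of_dominated_loc_of_deriv_le (𝕜 := ℝ)
    (μ := (μH[4] : Measure E5).restrict sph4) (F := fun t ω => f (planeRot i j t ω))
    (F' := fun t ω => rotDeriv i j f (planeRot i j t ω)) (x₀ := 0) (s := Set.univ)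
    (bound := fun _ => C) Filter.univ_mem
    (.of_forall fun t => (integrable_sphere (hf.continuous.comp (hrot t))).aestronglyMeasurable)
    (integrable_sphere (hf.continuous.comp (hrot 0)))
    (integrable_sphere (hcont.comp (hrot 0))).aestronglyMeasurable
    ((ae_restrict_mem measurableSet_sph4).mono fun ω hω t _ =>
      hC _ ((planeRot_mem_sph4 hij t).2 hω))
    (integrable_const C)
    (.of_forall fun ω t _ => hasDerivAt_comp_planeRot hij (hf.differentiable one_ne_zero) t ω)).2
  simp only [setIntegral_comp_planeRot hij] at hder
  exact hder.unique (hasDerivAt_const _ _)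

theorem pd_coord (i j : Fin 5) (x : E5) :
    pd i (fun y => (y j : ℂ)) x = if i = j then 1 else 0 := by
  have h : HasFDerivAt (fun y : E5 => (y j : ℂ))
      (Complex.ofRealCLM.comp (EuclideanSpace.proj (𝕜 := ℝ) j)) x :=
    (Complex.ofRealCLM.comp (EuclideanSpace.proj (𝕜 := ℝ) j)).hasFDerivAt
  rw [pd, h.fderiv]
  rcases eq_or_ne i j with rfl | hij
  · simp
  · simp [hij, hij.symm]

theorem pd_add (i : Fin 5) {f g : E5 → ℂ} (hf : Differentiable ℝ f) (hg : Differentiable ℝ g) :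
    pd i (fun x => f x + g x) = fun x => pd i f x + pd i g x := by
  ext x
  simp [pd, fderiv_fun_add (hf x) (hg x)]

theorem pd_sub (i : Fin 5) {f g : E5 → ℂ} (hf : Differentiable ℝ f) (hg : Differentiable ℝ g) :
    pd i (fun x => f x - g x) = fun x => pd i f x - pd i g x := by
  ext x
  simp [pd, fderiv_fun_sub (hf x) (hg x)]

theorem pd_const_mul (i : Fin 5) (c : ℂ) {f : E5 → ℂ} (hf : Differentiable ℝ f) :
    pd i (fun x => c * f x) = fun x => c * pd i f x := by
  ext x
  simp [pd, fderiv_const_mul (hf x)]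

theorem pd_sum (i : Fin 5) {f : Fin 5 → E5 → ℂ} (hf : ∀ j, Differentiable ℝ (f j)) :
    pd i (fun x => ∑ j, f j x) = fun x => ∑ j, pd i (f j) x := by
  ext x
  simp [pd, fderiv_fun_sum fun j _ => hf j x]

theorem pd_coord_mul (i j : Fin 5) {f : E5 → ℂ} (hf : Differentiable ℝ f) :
    pd i (fun x => (x j : ℂ) * f x) = fun x => x j * pd i f x + if i = j then f x else 0 := by
  ext x
  have h := pd_coord i j x
  rw [pd] at h
  simp [pd, fderiv_fun_mul ((contDiff_coord (n := 1) j).differentiable one_ne_zero x) (hf x), h]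

theorem pd_comm (i j : Fin 5) {f : E5 → ℂ} (hf : ContDiff ℝ 2 f) :
    pd i (pd j f) = pd j (pd i f) := by
  ext x
  have hd : DifferentiableAt ℝ (fderiv ℝ f) x :=
    (hf.fderiv_right (m := 1) (by norm_num)).differentiable one_ne_zero x
  have hsymm := (hf.contDiffAt (x := x)).isSymmSndFDerivAt (by simp)
  have key (v w : E5) : fderiv ℝ (fun y => fderiv ℝ f y v) x w = fderiv ℝ (fderiv ℝ f) x w v := by
    simp [fderiv_clm_apply hd (differentiableAt_const v)]
  change fderiv ℝ (fun y => fderiv ℝ f y _) x _ = fderiv ℝ (fun y => fderiv ℝ f y _) x _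
  rw [key, key, hsymm.eq]

/-- The Euler operator `x^j ∂_j`. -/
def euler (f : E5 → ℂ) (x : E5) : ℂ := ∑ j : Fin 5, (x j : ℂ) * pd j f x

theorem ContDiff.euler {n m : ℕ∞} {f : E5 → ℂ} (hf : ContDiff ℝ m f) (hnm : n + 1 ≤ m) :
    ContDiff ℝ n (euler f) :=
  ContDiff.sum fun j _ => (contDiff_coord j).mul (hf.pd hnm j)

theorem ContDiff.lap {n m : ℕ∞} {f : E5 → ℂ} (hf : ContDiff ℝ m f) (hnm : n + 1 + 1 ≤ m) :
    ContDiff ℝ n (lap f) :=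
  ContDiff.sum fun j _ => (hf.pd hnm j).pd le_rfl j

theorem pd_euler (i : Fin 5) {f : E5 → ℂ} (hf : ContDiff ℝ 2 f) :
    pd i (euler f) = fun x => euler (pd i f) x + pd i f x := by
  have hd (j : Fin 5) : Differentiable ℝ (pd j f) :=
    (ContDiff.pd (n := 1) (m := 2) hf (by norm_num) j).differentiable one_ne_zero
  have hc (j : Fin 5) : Differentiable ℝ fun x : E5 => (x j : ℂ) :=
    (contDiff_coord (n := 1) j).differentiable one_ne_zero
  unfold euler
  rw [pd_sum i fun j => (hc j).fun_mul (hd j)]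
  ext x
  simp [pd_coord_mul i _ (hd _), pd_comm i _ hf, Finset.sum_add_distrib]

theorem euler_add {f g : E5 → ℂ} (hf : Differentiable ℝ f) (hg : Differentiable ℝ g) :
    euler (fun x => f x + g x) = fun x => euler f x + euler g x := by
  ext x
  simp [euler, pd_add _ hf hg, mul_add, Finset.sum_add_distrib]

theorem euler_sub {f g : E5 → ℂ} (hf : Differentiable ℝ f) (hg : Differentiable ℝ g) :
    euler (fun x => f x - g x) = fun x => euler f x - euler g x := by
  ext x
  simp [euler, pd_sub _ hf hg, mul_sub, Finset.sum_sub_distrib]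

theorem euler_const_mul (c : ℂ) {f : E5 → ℂ} (hf : Differentiable ℝ f) :
    euler (fun x => c * f x) = fun x => c * euler f x := by
  ext x
  simp [euler, pd_const_mul _ c hf, Finset.mul_sum, mul_left_comm]

theorem sum_coord_mul_coord_mul_pd_pd {f : E5 → ℂ} (hf : ContDiff ℝ 2 f) (x : E5) :
    ∑ i : Fin 5, ∑ j : Fin 5, (x i : ℂ) * (x j : ℂ) * pd i (pd j f) x =
      euler (euler f) x - euler f x := by
  have h : euler (euler f) x = ∑ i : Fin 5, (x i : ℂ) * (euler (pd i f) x + pd i f x) := by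
    rw [euler]
    exact Finset.sum_congr rfl fun i _ => by rw [pd_euler i hf]
  rw [h]
  simp only [euler, mul_add, Finset.sum_add_distrib, add_sub_cancel_right, Finset.mul_sum,
    mul_assoc, pd_comm _ _ hf]

theorem lap_euler {f : E5 → ℂ} (hf : ContDiff ℝ 3 f) (x : E5) :
    lap (euler f) x = euler (lap f) x + 2 * lap f x := by
  have hf1 (i : Fin 5) : ContDiff ℝ 2 (pd i f) := ContDiff.pd (n := 2) (m := 3) hf (by norm_num) i
  have hf2 (i j : Fin 5) : Differentiable ℝ (pd j (pd i f)) :=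
    (ContDiff.pd (n := 1) (m := 2) (hf1 i) (by norm_num) j).differentiable one_ne_zero
  have he (i : Fin 5) : Differentiable ℝ (euler (pd i f)) :=
    (ContDiff.euler (n := 1) (m := 2) (hf1 i) (by norm_num)).differentiable one_ne_zero
  have h1 (i : Fin 5) : pd i (pd i (euler f)) x =
      euler (pd i (pd i f)) x + 2 * pd i (pd i f) x := by
    rw [pd_euler i (hf.of_le (by norm_num)), pd_add i (he i) ((hf1 i).differentiable two_ne_zero),
      pd_euler i (hf1 i)]
    ring
  have h2 : euler (lap f) x = ∑ i : Fin 5, euler (pd i (pd i f)) x := by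
    unfold lap euler
    rw [Finset.sum_comm]
    refine Finset.sum_congr rfl fun j _ => ?_
    rw [pd_sum j fun i => hf2 i i, Finset.mul_sum]
  rw [h2, lap, lap, Finset.mul_sum, ← Finset.sum_add_distrib]
  exact Finset.sum_congr rfl fun i _ => h1 i

theorem rotDeriv_rotDeriv (i j : Fin 5) {f : E5 → ℂ} (hf : ContDiff ℝ 2 f) (x : E5) :
    rotDeriv i j (rotDeriv i j f) x =
      (x i : ℂ) ^ 2 * pd j (pd j f) x + (x j : ℂ) ^ 2 * pd i (pd i f) x
        - 2 * (x i * x j * pd i (pd j f) x) - x i * pd i f x - x j * pd j f x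
        + if i = j then 2 * (x i * pd i f x) else 0 := by
  have hd (j : Fin 5) : Differentiable ℝ (pd j f) :=
    (ContDiff.pd (n := 1) (m := 2) hf (by norm_num) j).differentiable one_ne_zero
  have hc (j : Fin 5) : Differentiable ℝ fun x : E5 => (x j : ℂ) :=
    (contDiff_coord (n := 1) j).differentiable one_ne_zero
  have h (k : Fin 5) := pd_sub k ((hc i).fun_mul (hd j)) ((hc j).fun_mul (hd i))
  rw [rotDeriv]
  unfold rotDeriv
  rw [h, h, pd_coord_mul _ _ (hd _), pd_coord_mul _ _ (hd _), pd_coord_mul _ _ (hd _),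
    pd_coord_mul _ _ (hd _), pd_comm j i hf]
  rcases eq_or_ne i j with rfl | hij
  · simp
    ring
  · simp [hij, hij.symm]
    ring

theorem sum_rotDeriv_rotDeriv {f : E5 → ℂ} (hf : ContDiff ℝ 2 f) {x : E5} (hx : x ∈ sph4) :
    ∑ i : Fin 5, ∑ j : Fin 5, rotDeriv i j (rotDeriv i j f) x =
      2 * (lap f x - euler (euler f) x - 3 * euler f x) := by
  have hx1 : ∑ i : Fin 5, (x i : ℂ) ^ 2 = 1 := by
    have h : ‖x‖ = 1 := by simpa [sph4] using hx
    have h' := EuclideanSpace.real_norm_sq_eq x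
    rw [h, one_pow] at h'
    exact_mod_cast h'.symm
  have h1 : ∑ i : Fin 5, ∑ j : Fin 5, (x i : ℂ) ^ 2 * pd j (pd j f) x = lap f x := by
    rw [← Finset.sum_mul_sum, hx1, one_mul, lap]
  have h2 : ∑ i : Fin 5, ∑ j : Fin 5, (x j : ℂ) ^ 2 * pd i (pd i f) x = lap f x := by
    rw [Finset.sum_comm, h1]
  have h3 := sum_coord_mul_coord_mul_pd_pd hf x
  simp only [rotDeriv_rotDeriv _ _ hf, Finset.sum_add_distrib, Finset.sum_sub_distrib, h1, h2,
    Finset.sum_ite_eq, Finset.mem_univ, if_true, Finset.sum_const, Finset.card_univ,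
    Fintype.card_fin, nsmul_eq_mul]
  simp only [← Finset.mul_sum, h3]
  simp only [euler]
  push_cast
  ring

theorem setIntegral_sphericalLaplacian_eq_zero {f : E5 → ℂ} (hf : ContDiff ℝ 2 f) :
    ∫ ω in sph4, (lap f ω - euler (euler f) ω - 3 * euler f ω) ∂μH[4] = 0 := by
  have h1 (i j : Fin 5) : ContDiff ℝ 1 (rotDeriv i j f) :=
    ContDiff.rotDeriv (n := 1) (m := 2) hf (by norm_num) i j
  have h2 (i j : Fin 5) : Integrable (rotDeriv i j (rotDeriv i j f))
      ((μH[4] : Measure E5).restrict sph4) :=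
    integrable_sphere
      (ContDiff.rotDeriv (n := 0) (m := 1) (h1 i j) (by norm_num) i j).continuous
  have h : ∫ ω in sph4, 2 * (lap f ω - euler (euler f) ω - 3 * euler f ω) ∂μH[4] = 0 := by
    rw [← setIntegral_congr_fun measurableSet_sph4 fun ω hω => sum_rotDeriv_rotDeriv hf hω,
      integral_finsetSum _ fun i _ => integrable_finsetSum _ fun j _ => h2 i j]
    refine Finset.sum_eq_zero fun i _ => ?_
    rw [integral_finsetSum _ fun j _ => h2 i j]
    exact Finset.sum_eq_zero fun j _ => setIntegral_rotDeriv_eq_zero i j (h1 i j)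
  rw [integral_const_mul] at h
  simpa using h

theorem zeta_eq {w : (E5 → ℂ) × (E5 → ℂ)} (hw : ContDiff ℝ 2 w.1) (x : E5) :
    zeta w x = euler (euler w.1) x + 4 * euler w.1 x + 3 * w.1 x + euler w.2 x + 3 * w.2 x := by
  rw [zeta, sum_coord_mul_coord_mul_pd_pd hw]
  simp only [euler]
  ring

theorem zeta_Ltil {u : (E5 → ℂ) × (E5 → ℂ)} (hu1 : ContDiff ℝ 4 u.1) (hu2 : ContDiff ℝ 3 u.2)
    (x : E5) :
    zeta (Ltil u) x =
      (lap (fun y => euler u.1 y + u.1 y) x - euler (euler fun y => euler u.1 y + u.1 y) x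
        - 3 * euler (fun y => euler u.1 y + u.1 y) x) - zeta u x := by
  have hDu1 : ContDiff ℝ 3 (euler u.1) := ContDiff.euler (n := 3) (m := 4) hu1 (by norm_num)
  have hDDu1 : ContDiff ℝ 2 (euler (euler u.1)) :=
    ContDiff.euler (n := 2) (m := 3) hDu1 (by norm_num)
  have hDu2 : ContDiff ℝ 2 (euler u.2) := ContDiff.euler (n := 2) (m := 3) hu2 (by norm_num)
  have hlap : ContDiff ℝ 2 (lap u.1) := ContDiff.lap (n := 2) (m := 4) hu1 (by norm_num)
  have hg : ContDiff ℝ 3 fun y => euler u.1 y + u.1 y := hDu1.add (hu1.of_le (by norm_num))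
  have hDg : ContDiff ℝ 2 (euler fun y => euler u.1 y + u.1 y) :=
    ContDiff.euler (n := 2) (m := 3) hg (by norm_num)
  have h1 : (Ltil u).1 = fun y => u.2 y - (euler u.1 y + u.1 y) := by
    ext y
    simp only [Ltil, euler]
    ring
  have h2 : (Ltil u).2 = fun y => lap u.1 y - euler u.2 y - 2 * u.2 y := rfl
  have hL : ContDiff ℝ 2 (Ltil u).1 := by
    rw [h1]
    exact (hu2.sub hg).of_le (by norm_num)
  have d1 := hu1.differentiable four_ne_zero
  have d2 := hu2.differentiable three_ne_zero
  have dD1 := hDu1.differentiable three_ne_zero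
  have dD2 := hDu2.differentiable two_ne_zero
  have dl := hlap.differentiable two_ne_zero
  have hlapg : lap (fun y => euler u.1 y + u.1 y) x = euler (lap u.1) x + 3 * lap u.1 x := by
    have hpd (j : Fin 5) : pd j (pd j fun y => euler u.1 y + u.1 y) x =
        pd j (pd j (euler u.1)) x + pd j (pd j u.1) x := by
      rw [pd_add j dD1 d1, pd_add j
        ((ContDiff.pd (n := 2) (m := 3) hDu1 (by norm_num) j).differentiable two_ne_zero)
        ((ContDiff.pd (n := 3) (m := 4) hu1 (by norm_num) j).differentiable three_ne_zero)]
    have h := lap_euler (hu1.of_le (by norm_num)) x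
    rw [lap, Finset.sum_congr rfl fun j _ => hpd j, Finset.sum_add_distrib]
    simp only [lap] at h ⊢
    rw [h]
    ring
  have hEL : euler (Ltil u).1 = fun y => euler u.2 y - euler (fun z => euler u.1 z + u.1 z) y := by
    rw [h1, euler_sub d2 (hg.differentiable three_ne_zero)]
  have hEL2 : euler (Ltil u).2 = fun y => euler (lap u.1) y - euler (euler u.2) y
      - 2 * euler u.2 y := by
    rw [h2, euler_sub (dl.fun_sub dD2) (d2.const_mul 2), euler_sub dl dD2, euler_const_mul 2 d2]
  rw [zeta_eq hL, zeta_eq (hu1.of_le (by norm_num)), hEL, hEL2,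
    euler_sub dD2 (hDg.differentiable two_ne_zero), hlapg, h1, h2, euler_add dD1 d1]
  ring

theorem continuous_zeta {w : (E5 → ℂ) × (E5 → ℂ)} (hw1 : ContDiff ℝ 2 w.1)
    (hw2 : ContDiff ℝ 1 w.2) : Continuous (zeta w) := by
  have h1 : ContDiff ℝ 1 (euler w.1) := ContDiff.euler (n := 1) (m := 2) hw1 (by norm_num)
  have h2 : Continuous (euler (euler w.1)) :=
    (ContDiff.euler (n := 0) (m := 1) h1 (by norm_num)).continuous
  have h3 : Continuous (euler w.2) :=
    (ContDiff.euler (n := 0) (m := 1) hw2 (by norm_num)).continuous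
  have h1' := h1.continuous
  have h4 := hw1.continuous
  have h5 := hw2.continuous
  rw [funext (zeta_eq hw1)]
  fun_prop

theorem setIntegral_zeta_Ltil {u : (E5 → ℂ) × (E5 → ℂ)} (hu1 : ContDiff ℝ 4 u.1)
    (hu2 : ContDiff ℝ 3 u.2) :
    ∫ ω in sph4, zeta (Ltil u) ω ∂μH[4] = -∫ ω in sph4, zeta u ω ∂μH[4] := by
  have hg : ContDiff ℝ 2 fun y => euler u.1 y + u.1 y :=
    (ContDiff.euler (n := 2) (m := 4) hu1 (by norm_num)).add (hu1.of_le (by norm_num))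
  have hDg : ContDiff ℝ 1 (euler fun y => euler u.1 y + u.1 y) :=
    ContDiff.euler (n := 1) (m := 2) hg (by norm_num)
  have hDDg : ContDiff ℝ 0 (euler (euler fun y => euler u.1 y + u.1 y)) :=
    ContDiff.euler (n := 0) (m := 1) hDg (by norm_num)
  have hlap : ContDiff ℝ 0 (lap fun y => euler u.1 y + u.1 y) :=
    ContDiff.lap (n := 0) (m := 2) hg (by norm_num)
  simp only [zeta_Ltil hu1 hu2]
  rw [integral_sub, setIntegral_sphericalLaplacian_eq_zero hg, zero_sub]
  · exact integrable_sphere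
      ((hlap.continuous.sub hDDg.continuous).sub (hDg.continuous.const_mul 3))
  · exact integrable_sphere
      (continuous_zeta (hu1.of_le (by norm_num)) (hu2.of_le (by norm_num)))

/-- Lemma 4.5 (Lumer1b): `Re (L̃u | u)₅ = −‖u‖₅²` for all `u = (u₁,u₂)` with
`u₁ ∈ C⁴(cl B⁵;ℂ)`, `u₂ ∈ C³(cl B⁵;ℂ)`. -/
theorem stmt_5 (u : (E5 → ℂ) × (E5 → ℂ))
    (hu1 : ContDiff ℝ 4 u.1) (hu2 : ContDiff ℝ 3 u.2) :
    (ip5 (Ltil u) u).re = -(ip5 u u).re := by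
  rw [ip5, ip5, setIntegral_zeta_Ltil hu1 hu2, neg_mul, Complex.neg_re]

end
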